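/- Let p be a polynomial of degree d with |p(x)| ≤ c for all x ∈ [a,b]. Then its derivative satisfies |p'(x)| ≤ 2c·d²/(b−a) for all x ∈ [a,b] (Markov brothers' inequality); consequently p is Lipschitz on [a,b] with constant 2c·d²/(b−a). -/

import Mathlib

open Polynomial

namespace MarkovInequality

open Real Finset Polynomial.Chebyshev

/-- The zeros of `cos (n * θ)` in `[0, 2π]` are `rootAngle n k` for `k < 2 * n`. -/
noncomputable def rootAngle (n k : ℕ) : ℝ := (2 * k + 1) * π / (2 * n)

lemma nat_mul_rootAngle {n : ℕ} (hn : n ≠ 0) (k : ℕ) :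
    n * rootAngle n k = k * π + π / 2 := by
  unfold rootAngle
  field_simp

lemma cos_nat_mul_rootAngle {n : ℕ} (hn : n ≠ 0) (k : ℕ) : cos (n * rootAngle n k) = 0 := by
  rw [nat_mul_rootAngle hn, cos_add_pi_div_two, sin_nat_mul_pi, neg_zero]

lemma sin_nat_mul_rootAngle {n : ℕ} (hn : n ≠ 0) (k : ℕ) :
    sin (n * rootAngle n k) = (-1) ^ k := by
  rw [nat_mul_rootAngle hn, sin_add_pi_div_two, cos_nat_mul_pi]

lemma abs_sin_nat_mul_rootAngle {n : ℕ} (hn : n ≠ 0) (k : ℕ) :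
    |sin (n * rootAngle n k)| = 1 := by
  rw [sin_nat_mul_rootAngle hn, abs_neg_one_pow]

lemma rootAngle_pos {n : ℕ} (hn : n ≠ 0) (k : ℕ) : 0 < rootAngle n k := by
  unfold rootAngle
  positivity

lemma rootAngle_lt_pi {n k : ℕ} (hk : k < n) : rootAngle n k < π := by
  have hn : (0 : ℝ) < n := by exact_mod_cast (Nat.zero_le k).trans_lt hk
  have h : (2 * k + 1 : ℝ) < 2 * n := by exact_mod_cast (show 2 * k + 1 < 2 * n by lia)
  rw [rootAngle, div_lt_iff₀ (by positivity), mul_comm]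
  gcongr

lemma rootAngle_lt_two_pi {n k : ℕ} (hk : k < 2 * n) : rootAngle n k < 2 * π := by
  have hn : (0 : ℝ) < n := by exact_mod_cast (show 0 < n by lia)
  have h : (2 * k + 1 : ℝ) < 2 * (2 * n) := by exact_mod_cast (show 2 * k + 1 < 2 * (2 * n) by lia)
  rw [rootAngle, div_lt_iff₀ (by positivity)]
  nlinarith [pi_pos]

lemma one_sub_cos_rootAngle_pos {n k : ℕ} (hk : k < 2 * n) : 0 < 1 - cos (rootAngle n k) := by
  have h₀ := rootAngle_pos (show n ≠ 0 by lia) k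
  have h₁ := rootAngle_lt_two_pi hk
  refine sub_pos.mpr (lt_of_le_of_ne (cos_le_one _) fun h => h₀.ne' ?_)
  exact (cos_eq_one_iff_of_lt_of_lt (by linarith) h₁).mp h

lemma sum_cos_nat_mul_rootAngle {n j : ℕ} (hj : 0 < j) (hjn : j < 2 * n) :
    ∑ k ∈ range (2 * n), cos (j * rootAngle n k) = 0 := by
  have hn : (0 : ℝ) < n := by exact_mod_cast (show 0 < n by lia)
  set h : ℝ := j * π / (2 * n) with hh
  have hsin : 0 < sin h := by
    have hj' : (0 : ℝ) < j := by exact_mod_cast hj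
    have hjn' : (j : ℝ) < 2 * n := by exact_mod_cast hjn
    refine sin_pos_of_pos_of_lt_pi (by positivity) ?_
    rw [hh, div_lt_iff₀ (by positivity), mul_comm]
    gcongr
  have hstep (k : ℕ) : 2 * sin h * cos (j * rootAngle n k) =
      sin (2 * (k + 1 : ℕ) * h) - sin (2 * k * h) := by
    rw [show (j : ℝ) * rootAngle n k = (2 * k + 1) * h by rw [hh, rootAngle]; ring, sin_sub_sin]
    congr 2
    · congr 1; push_cast; ring
    · push_cast; ring
  have hsum : 2 * sin h * ∑ k ∈ range (2 * n), cos (j * rootAngle n k) = 0 := by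
    rw [mul_sum, sum_congr rfl fun k _ => hstep k,
      sum_range_sub (fun k : ℕ => sin (2 * k * h)) (2 * n)]
    rw [show 2 * ((2 * n : ℕ) : ℝ) * h = ((2 * j : ℕ) : ℝ) * π by rw [hh]; push_cast; field,
      sin_nat_mul_pi]
    simp
  exact (mul_eq_zero.mp hsum).resolve_left (by positivity)

/-- The weights of M. Riesz's interpolation formula for the derivative of a trigonometric
polynomial of degree at most `n`. -/
noncomputable def rieszWeight (n k : ℕ) : ℝ :=
  sin (n * rootAngle n k) / (2 * n * (1 - cos (rootAngle n k)))

lemma rieszWeight_mul {n k : ℕ} (hk : k < 2 * n) :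
    rieszWeight n k * (1 - cos (rootAngle n k)) = sin (n * rootAngle n k) / (2 * n) := by
  have h := (one_sub_cos_rootAngle_pos hk).ne'
  have hn : (n : ℝ) ≠ 0 := by exact_mod_cast (show n ≠ 0 by lia)
  rw [rieszWeight]
  field_simp

lemma abs_rieszWeight {n k : ℕ} (hk : k < 2 * n) :
    |rieszWeight n k| = rieszWeight n k * sin (n * rootAngle n k) := by
  have h := one_sub_cos_rootAngle_pos hk
  have hn : n ≠ 0 := by lia
  have hsq : sin (n * rootAngle n k) ^ 2 = 1 := by
    rw [← sq_abs, abs_sin_nat_mul_rootAngle hn, one_pow]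
  rw [rieszWeight, abs_div, abs_sin_nat_mul_rootAngle hn, abs_of_nonneg (by positivity),
    div_mul_eq_mul_div, ← sq, hsq]

lemma sum_rieszWeight_mul_sin_succ_succ {n m : ℕ} (hm : m + 1 < n) :
    ∑ k ∈ range (2 * n), rieszWeight n k * sin ((m + 2 : ℕ) * rootAngle n k) =
      2 * ∑ k ∈ range (2 * n), rieszWeight n k * sin ((m + 1 : ℕ) * rootAngle n k) -
        ∑ k ∈ range (2 * n), rieszWeight n k * sin (m * rootAngle n k) := by
  have hn : n ≠ 0 := by lia
  have key : ∑ k ∈ range (2 * n), -(1 / n) * cos ((n - (m + 1) : ℕ) * rootAngle n k) = 0 := by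
    rw [← mul_sum, sum_cos_nat_mul_rootAngle (by lia) (by lia), mul_zero]
  rw [mul_sum, ← sum_sub_distrib, ← sub_eq_zero, ← sum_sub_distrib, ← key]
  refine sum_congr rfl fun k hk => ?_
  have hw := rieszWeight_mul (mem_range.mp hk)
  set t := rootAngle n k
  have h₁ : sin ((m + 2 : ℕ) * t) + sin (m * t) = 2 * sin ((m + 1 : ℕ) * t) * cos t := by
    rw [sin_add_sin]
    push_cast
    ring_nf
  have h₂ : cos ((n - (m + 1) : ℕ) * t) = sin (n * t) * sin ((m + 1 : ℕ) * t) := by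
    rw [Nat.cast_sub hm.le, sub_mul, cos_sub, cos_nat_mul_rootAngle hn]
    ring
  rw [h₂]
  linear_combination rieszWeight n k * h₁ - 2 * sin ((m + 1 : ℕ) * t) * hw

lemma sum_rieszWeight_mul_sin_eq_mul {n : ℕ} (m : ℕ) (hm : m ≤ n) :
    ∑ k ∈ range (2 * n), rieszWeight n k * sin (m * rootAngle n k) =
      m * ∑ k ∈ range (2 * n), rieszWeight n k * sin (rootAngle n k) := by
  induction m using Nat.twoStepInduction with
  | zero => simp
  | one => simp
  | more m ih₀ ih₁ =>
    rw [sum_rieszWeight_mul_sin_succ_succ (by lia), ih₀ (by lia), ih₁ (by lia)]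
    push_cast
    ring

lemma sum_rieszWeight_mul_sin {n m : ℕ} (hn : n ≠ 0) (hm : m ≤ n) :
    ∑ k ∈ range (2 * n), rieszWeight n k * sin (m * rootAngle n k) = m := by
  have hsub : ∑ k ∈ range (2 * n), rieszWeight n k * sin (n * rootAngle n k) -
      ∑ k ∈ range (2 * n), rieszWeight n k * sin ((n - 1 : ℕ) * rootAngle n k) = 1 := by
    rw [← sum_sub_distrib, sum_congr rfl (g := fun _ => (1 / (2 * n) : ℝ)) fun k hk => ?_]
    · simp
      field
    · have hw := rieszWeight_mul (mem_range.mp hk)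
      have hsq : sin (n * rootAngle n k) ^ 2 = 1 := by
        rw [← sq_abs, abs_sin_nat_mul_rootAngle hn, one_pow]
      have hsin : sin ((n - 1 : ℕ) * rootAngle n k) =
          sin (n * rootAngle n k) * cos (rootAngle n k) := by
        rw [Nat.cast_sub (Nat.one_le_iff_ne_zero.mpr hn), Nat.cast_one, sub_mul, one_mul, sin_sub,
          cos_nat_mul_rootAngle hn]
        ring
      rw [hsin]
      linear_combination sin (n * rootAngle n k) * hw + hsq / (2 * n)
  rw [sum_rieszWeight_mul_sin_eq_mul n le_rfl, sum_rieszWeight_mul_sin_eq_mul (n - 1) (by lia),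
    Nat.cast_sub (Nat.one_le_iff_ne_zero.mpr hn)] at hsub
  rw [sum_rieszWeight_mul_sin_eq_mul m hm]
  push_cast at hsub
  linear_combination m * hsub

lemma sum_rieszWeight_mul_cos {n : ℕ} (hn : n ≠ 0) (m : ℕ) :
    ∑ k ∈ range (2 * n), rieszWeight n k * cos (m * rootAngle n k) = 0 := by
  have hrefl := sum_range_reflect (fun k => rieszWeight n k * cos (m * rootAngle n k)) (2 * n)
  have hneg : ∑ k ∈ range (2 * n), rieszWeight n (2 * n - 1 - k) *
      cos (m * rootAngle n (2 * n - 1 - k)) =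
      -∑ k ∈ range (2 * n), rieszWeight n k * cos (m * rootAngle n k) := by
    rw [← sum_neg_distrib]
    refine sum_congr rfl fun k hk => ?_
    have hk := mem_range.mp hk
    have hangle : rootAngle n (2 * n - 1 - k) = 2 * π - rootAngle n k := by
      rw [rootAngle, rootAngle, show 2 * n - 1 - k = 2 * n - (k + 1) by lia, Nat.cast_sub hk]
      push_cast
      field
    rw [rieszWeight, hangle, mul_sub (n : ℝ) (2 * π), mul_sub (m : ℝ) (2 * π),
      sin_nat_mul_two_pi_sub, cos_nat_mul_two_pi_sub, cos_two_pi_sub, rieszWeight]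
    ring
  linarith

lemma derivative_T_real_eval_cos_mul_sin (n : ℕ) (θ : ℝ) :
    (derivative (T ℝ n)).eval (cos θ) * sin θ = n * sin (n * θ) := by
  have := U_real_cos θ (n - 1)
  rw [T_derivative_eq_U, eval_mul, mul_assoc, this]
  simp

/-- **M. Riesz's interpolation formula** for the trigonometric polynomial `θ ↦ P (cos θ)`. -/
lemma derivative_eval_cos_mul_sin {n : ℕ} (hn : n ≠ 0) {P : ℝ[X]} (hP : P.degree ≤ n) (θ : ℝ) :
    P.derivative.eval (cos θ) * sin θ =
      -∑ k ∈ range (2 * n), rieszWeight n k * P.eval (cos (θ + rootAngle n k)) := by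
  have hmem : P ∈ degreeLE ℝ n := mem_degreeLE.mpr hP
  rw [← Sequence.span_degreeLE (chebyshevTsequence ℝ) (by simp)] at hmem
  clear hP
  induction hmem using Submodule.span_induction with
  | zero => simp
  | add p q _ _ hp hq =>
    simp only [derivative_add, eval_add, mul_add, add_mul, sum_add_distrib]
    rw [hp, hq, neg_add]
  | smul a p _ hp =>
    simp only [derivative_smul, eval_smul, smul_eq_mul, mul_left_comm _ a, ← mul_sum]
    rw [mul_assoc, hp, mul_neg]
  | mem p hp =>
    obtain ⟨m, hm, rfl⟩ := hp
    change (derivative (T ℝ m)).eval (cos θ) * sin θ =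
      -∑ k ∈ range (2 * n), rieszWeight n k * (T ℝ m).eval (cos (θ + rootAngle n k))
    have hcos (k : ℕ) : rieszWeight n k * (T ℝ m).eval (cos (θ + rootAngle n k)) =
        cos (m * θ) * (rieszWeight n k * cos (m * rootAngle n k)) -
          sin (m * θ) * (rieszWeight n k * sin (m * rootAngle n k)) := by
      rw [T_real_cos, Int.cast_natCast, mul_add, cos_add]
      ring
    rw [sum_congr rfl fun k _ => hcos k, sum_sub_distrib, ← mul_sum, ← mul_sum,
      sum_rieszWeight_mul_cos hn, sum_rieszWeight_mul_sin hn hm,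
      derivative_T_real_eval_cos_mul_sin]
    ring

/-- **Bernstein's inequality** for real polynomials on `[-1, 1]`. -/
lemma abs_derivative_eval_cos_mul_sin_le {n : ℕ} (hn : n ≠ 0) {P : ℝ[X]} (hP : P.degree ≤ n)
    {M : ℝ} (hM : ∀ x ∈ Set.Icc (-1) 1, |P.eval x| ≤ M) (θ : ℝ) :
    |P.derivative.eval (cos θ) * sin θ| ≤ n * M := by
  rw [derivative_eval_cos_mul_sin hn hP, abs_neg, ← sum_rieszWeight_mul_sin hn le_rfl, sum_mul]
  refine (abs_sum_le_sum_abs _ _).trans (sum_le_sum fun k hk => ?_)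
  rw [abs_mul, ← abs_rieszWeight (mem_range.mp hk)]
  gcongr
  exact hM _ (cos_mem_Icc _)

/-- To the right of all nodes, a polynomial dominated at the nodes by the derivative of the nodal
polynomial stays dominated by it. -/
lemma abs_eval_le_derivative_nodal_eval {ι : Type*} [DecidableEq ι] {s : Finset ι} {v : ι → ℝ}
    (hv : Set.InjOn v s) {q : ℝ[X]} (hq : q.degree < #s) {K : ℝ}
    (hK : ∀ i ∈ s, |q.eval (v i)| ≤ K * |(Lagrange.nodal s v).derivative.eval (v i)|)
    {x : ℝ} (hx : ∀ i ∈ s, v i ≤ x) :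
    |q.eval x| ≤ K * (Lagrange.nodal s v).derivative.eval x := by
  rw [Lagrange.eq_interpolate hv hq, Lagrange.interpolate_apply, eval_finsetSum,
    Lagrange.derivative_nodal, eval_finsetSum, mul_sum]
  refine (abs_sum_le_sum_abs _ _).trans (sum_le_sum fun i hi => ?_)
  have hne : (Lagrange.nodal s v).derivative.eval (v i) ≠ 0 := by
    have := Lagrange.nodalWeight_ne_zero hv hi
    rw [Lagrange.nodalWeight_eq_eval_derivative_nodal hi] at this
    exact fun h => this (by rw [h, inv_zero])
  have hnonneg : 0 ≤ (Lagrange.nodal (s.erase i) v).eval x := by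
    rw [Lagrange.eval_nodal]
    exact prod_nonneg fun j hj => sub_nonneg.mpr (hx j (mem_of_mem_erase hj))
  rw [Lagrange.basis_eq_prod_sub_inv_mul_nodal_div hi, ← Lagrange.nodal_erase_eq_nodal_div hi,
    Lagrange.nodalWeight_eq_eval_derivative_nodal hi, eval_mul, eval_mul, eval_C, eval_C, abs_mul,
    abs_mul, abs_of_nonneg hnonneg, ← mul_assoc, abs_inv]
  gcongr
  rw [← div_eq_mul_inv, div_le_iff₀ (abs_pos.mpr hne)]
  exact hK i hi

lemma injOn_cos_rootAngle (n : ℕ) : Set.InjOn (fun k => cos (rootAngle n k)) (range n) := by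
  refine (injOn_cos.comp (fun k hk l _ h => ?_) fun k hk => ?_ :
    Set.InjOn (cos ∘ rootAngle n) (range n))
  · have hn : (0 : ℝ) < n := by exact_mod_cast (Nat.zero_le k).trans_lt (mem_range.mp hk)
    unfold rootAngle at h
    field_simp at h
    simpa using h
  · have hk := mem_range.mp hk
    exact ⟨(rootAngle_pos (by lia) k).le, (rootAngle_lt_pi hk).le⟩

lemma T_real_eq_mul_nodal (n : ℕ) :
    T ℝ n = C (2 ^ (n - 1) : ℝ) * Lagrange.nodal (range n) (fun k => cos (rootAngle n k)) := by
  have hroots : (T ℝ n).roots = ((range n).image fun k => cos (rootAngle n k)).val :=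
    roots_T_real n
  have hcard : (T ℝ n).roots.card = (T ℝ n).natDegree := by
    rw [hroots, ← card_def, card_image_of_injOn (injOn_cos_rootAngle n)]
    simp
  have h := C_leadingCoeff_mul_prod_multiset_X_sub_C hcard
  rw [hroots] at h
  conv_lhs => rw [← h]
  rw [Lagrange.nodal, ← prod_image (f := fun y => X - C y) (injOn_cos_rootAngle n)]
  simp [prod_eq_multiset_prod]

lemma abs_derivative_eval_le_of_nonneg {n : ℕ} (hn : n ≠ 0) {P : ℝ[X]} (hP : P.degree ≤ n)
    {M : ℝ} (hM : ∀ x ∈ Set.Icc (-1) 1, |P.eval x| ≤ M) {x : ℝ} (hx₀ : 0 ≤ x) (hx₁ : x ≤ 1) :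
    |P.derivative.eval x| ≤ n ^ 2 * M := by
  have hM₀ : 0 ≤ M := (abs_nonneg _).trans (hM 0 (by simp))
  have hn₀ : (0 : ℝ) < n := by positivity
  have hbern := abs_derivative_eval_cos_mul_sin_le hn hP hM
  rcases le_or_gt (rootAngle n 0) (arccos x) with hθ | hθ
  · have hsin : 1 / n ≤ sin (arccos x) := by
      refine le_trans ?_ (mul_le_sin (arccos_nonneg x) (arccos_le_pi_div_two.mpr hx₀))
      calc (1 / n : ℝ) = 2 / π * rootAngle n 0 := by
            rw [rootAngle]
            push_cast
            field
        _ ≤ _ := by gcongr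
    have h := hbern (arccos x)
    rw [cos_arccos (by linarith) hx₁, abs_mul,
      abs_of_nonneg (a := sin _) (le_trans (by positivity) hsin)] at h
    have h' : |P.derivative.eval x| * (1 / n) ≤ n * M := le_trans (by gcongr) h
    rw [mul_one_div, div_le_iff₀ hn₀] at h'
    linarith
  · have hdeg : P.derivative.degree < #(range n) := by
      rw [card_range]
      rcases eq_or_ne P 0 with rfl | hP₀
      · simp
      · exact (degree_derivative_lt hP₀).trans_le hP
    have hT : derivative (T ℝ n) = C (2 ^ (n - 1) : ℝ) *
        (Lagrange.nodal (range n) (fun k => cos (rootAngle n k))).derivative := by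
      rw [← derivative_C_mul, ← T_real_eq_mul_nodal]
    have hnode : ∀ k ∈ range n, |P.derivative.eval (cos (rootAngle n k))| ≤ (M * 2 ^ (n - 1)) *
        |(Lagrange.nodal (range n) (fun k => cos (rootAngle n k))).derivative.eval
          (cos (rootAngle n k))| := by
      intro k hk
      have hsin : 0 < sin (rootAngle n k) :=
        sin_pos_of_pos_of_lt_pi (rootAngle_pos hn k) (rootAngle_lt_pi (mem_range.mp hk))
      refine le_of_mul_le_mul_right ?_ hsin
      have hT' := congrArg abs (derivative_T_real_eval_cos_mul_sin n (rootAngle n k))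
      rw [abs_mul, abs_mul, abs_sin_nat_mul_rootAngle hn, hT, eval_mul, eval_C, abs_mul,
        abs_of_pos hsin, abs_of_pos hn₀, abs_of_pos (a := (2 : ℝ) ^ (n - 1)) (by positivity)] at hT'
      have h := hbern (rootAngle n k)
      rw [abs_mul, abs_of_pos hsin] at h
      linear_combination h - M * hT'
    have hle := abs_eval_le_derivative_nodal_eval (injOn_cos_rootAngle n) hdeg hnode
      (x := x) fun k hkn => by
        have hk : rootAngle n 0 ≤ rootAngle n k := by
          unfold rootAngle
          gcongr
          exact Nat.zero_le k
        rw [← cos_arccos (by linarith) hx₁]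
        exact cos_le_cos_of_nonneg_of_le_pi (arccos_nonneg x)
          (rootAngle_lt_pi (mem_range.mp hkn)).le (hθ.le.trans hk)
    rw [mul_assoc, ← eval_C_mul, ← hT] at hle
    have hT₁ := abs_iterate_derivative_T_real_le n 1 (abs_le.mpr ⟨by linarith, hx₁⟩)
    simp only [Function.iterate_one, derivative_T_eval_one] at hT₁
    calc _ ≤ _ := hle
      _ ≤ M * n ^ 2 := by gcongr; exact_mod_cast (le_abs_self _).trans hT₁
      _ = n ^ 2 * M := mul_comm _ _

/-- **Markov's inequality** on `[-1, 1]`. -/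
lemma abs_derivative_eval_le {n : ℕ} {P : ℝ[X]} (hP : P.natDegree ≤ n)
    {M : ℝ} (hM : ∀ x ∈ Set.Icc (-1) 1, |P.eval x| ≤ M) {x : ℝ} (hx : x ∈ Set.Icc (-1) 1) :
    |P.derivative.eval x| ≤ n ^ 2 * M := by
  rcases eq_or_ne n 0 with rfl | hn
  · rw [eq_C_of_natDegree_le_zero hP]
    simp
  have hdeg : P.degree ≤ n := natDegree_le_iff_degree_le.mp hP
  rcases le_total 0 x with hx₀ | hx₀
  · exact abs_derivative_eval_le_of_nonneg hn hdeg hM hx₀ hx.2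
  · have h := abs_derivative_eval_le_of_nonneg hn (P := P.comp (-X)) (M := M)
      (natDegree_le_iff_degree_le.mp (by simpa [natDegree_comp] using hP))
      (fun y hy => by simpa using hM (-y) ⟨by linarith [hy.2], by linarith [hy.1]⟩)
      (x := -x) (by linarith) (by linarith [hx.1])
    simpa [derivative_comp] using h

/-- **Markov's inequality** on `[a, b]`. -/
lemma abs_derivative_eval_le_of_mem_Icc {n : ℕ} {P : ℝ[X]} (hP : P.natDegree ≤ n) {a b M : ℝ}
    (hab : a < b) (hM : ∀ x ∈ Set.Icc a b, |P.eval x| ≤ M) {x : ℝ} (hx : x ∈ Set.Icc a b) :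
    |P.derivative.eval x| ≤ 2 * M * n ^ 2 / (b - a) := by
  have hba : 0 < b - a := sub_pos.mpr hab
  set L : ℝ[X] := C ((b - a) / 2) * X + C ((a + b) / 2) with hL
  have hLdeg : L.natDegree ≤ 1 := natDegree_linear_le
  have h := abs_derivative_eval_le (n := n) (P := P.comp L) (M := M)
    (x := (2 * x - (a + b)) / (b - a))
    (natDegree_comp_le.trans ((Nat.mul_le_mul hP hLdeg).trans (mul_one n).le))
    (fun y hy => by
      rw [eval_comp]
      refine hM _ ?_
      simp only [hL, eval_add, eval_mul, eval_C, eval_X]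
      constructor <;> nlinarith [hy.1, hy.2])
    ⟨by rw [le_div_iff₀ hba]; linarith [hx.1], by rw [div_le_iff₀ hba]; linarith [hx.2]⟩
  have hLx : L.eval ((2 * x - (a + b)) / (b - a)) = x := by
    simp only [hL, eval_add, eval_mul, eval_C, eval_X]
    field
  have hL' : L.derivative = C ((b - a) / 2) := by simp [hL]
  rw [derivative_comp, eval_mul, eval_comp, hLx, hL', eval_C, abs_mul,
    abs_of_pos (a := (b - a) / 2) (by positivity)] at h
  rw [le_div_iff₀ hba]
  linarith

end MarkovInequality

/-- **Markov brothers' inequality and the resulting Lipschitz bound.**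
Let `p` be a real polynomial of degree at most `d` with `|p(x)| ≤ c` on `[a,b]`, where
`a < b`. Then `|p'(x)| ≤ 2c·d²/(b−a)` on `[a,b]`, and consequently `p` is Lipschitz on
`[a,b]` with constant `2c·d²/(b−a)`. -/
theorem markov_polynomial_inequality (p : Polynomial ℝ) (d : ℕ) (hd : p.natDegree ≤ d)
    (a b c : ℝ) (hab : a < b) (hc : ∀ x ∈ Set.Icc a b, |p.eval x| ≤ c) :
    (∀ x ∈ Set.Icc a b, |p.derivative.eval x| ≤ 2 * c * d ^ 2 / (b - a)) ∧
    (∀ x ∈ Set.Icc a b, ∀ y ∈ Set.Icc a b,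
      |p.eval x - p.eval y| ≤ 2 * c * d ^ 2 / (b - a) * |x - y|) := by
  have hderiv : ∀ x ∈ Set.Icc a b, |p.derivative.eval x| ≤ 2 * c * d ^ 2 / (b - a) :=
    fun x hx => MarkovInequality.abs_derivative_eval_le_of_mem_Icc hd hab hc hx
  refine ⟨hderiv, fun x hx y hy => ?_⟩
  exact (convex_Icc a b).norm_image_sub_le_of_norm_hasDerivWithin_le
    (fun z _ => (p.hasDerivAt z).hasDerivWithinAt) hderiv hy hx
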